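/- Consider a single access by a minimally self-adjusting BST algorithm to element s in tree T, producing tree T'. For every monotone set X of nodes of the search path and every positive weight function w: Φ_T(X) − Φ_{T'}(X) + log(W/w(s)) ≥ 0. -/

import Mathlib

namespace Paper

inductive BTree where
  | nil : BTree
  | node : BTree → ℕ → BTree → BTree
deriving DecidableEq

namespace BTree

def keys : BTree → Finset ℕ
  | nil => ∅
  | node l x r => insert x (keys l ∪ keys r)

def root? : BTree → Option ℕ
  | nil => none
  | node _ x _ => some x

def isBST : BTree → Prop
  | nil => True
  | node l x r => (∀ y ∈ keys l, y < x) ∧ (∀ y ∈ keys r, x < y) ∧ isBST l ∧ isBST r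

def subtree? (s : ℕ) : BTree → Option BTree
  | nil => none
  | node l x r => if s = x then some (node l x r) else if s < x then subtree? s l else subtree? s r

/-- The set of keys of the subtree rooted at `s` (∅ if `s` is not in the tree). -/
def subtreeKeys (T : BTree) (s : ℕ) : Finset ℕ := ((subtree? s T).map keys).getD ∅

/-- The search path to `s`, listed from the root downwards. -/
def pathList (s : ℕ) : BTree → List ℕ
  | nil => []
  | node l x r => if s = x then [x] else if s < x then x :: pathList s l else x :: pathList s r

def pathSet (T : BTree) (s : ℕ) : Finset ℕ := (pathList s T).toFinset

def nodeDepth (s : ℕ) : BTree → ℕ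
  | nil => 0
  | node l x r => if s = x then 0 else if s < x then nodeDepth s l + 1 else nodeDepth s r + 1

/-- Number of right-going edges on the path from the root to `s`. -/
def rightDepth (s : ℕ) : BTree → ℕ
  | nil => 0
  | node l x r => if s = x then 0 else if s < x then rightDepth s l else rightDepth s r + 1

/-- Number of left-going edges on the path from the root to `s`. -/
def leftDepth (s : ℕ) : BTree → ℕ
  | nil => 0
  | node l x r => if s = x then 0 else if s < x then leftDepth s l + 1 else leftDepth s r

def leafCount : BTree → ℕ
  | nil => 0
  | node nil _ nil => 1
  | node l _ r => leafCount l + leafCount r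

/-- The wing partition of a BST, each wing listed from its topmost node downwards. -/
def wings : BTree → List (List ℕ)
  | nil => []
  | node l x r =>
    match wings l with
    | [] => [x] :: wings r
    | wl :: rest => (x :: wl) :: (rest ++ wings r)

end BTree

open BTree

/-- The left-leaning path on `[n]`: `n` at the root, `1` at the deepest node. -/
def leftPathTree : ℕ → BTree
  | 0 => BTree.nil
  | n + 1 => BTree.node (leftPathTree n) (n + 1) BTree.nil

/-- Number of side alternations (w.r.t. `s`) between adjacent elements of a list. -/
def sideAlt (s : ℕ) : List ℕ → ℕ
  | x :: y :: rest => (if (x < s ∧ s < y) ∨ (y < s ∧ s < x) then 1 else 0) + sideAlt s (y :: rest)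
  | _ => 0

/-- The set of elements involved in side alternations (w.r.t. `s`) in a list. -/
def zigzagSet (s : ℕ) : List ℕ → Finset ℕ
  | x :: y :: rest =>
    (if (x < s ∧ s < y) ∨ (y < s ∧ s < x) then ({x, y} : Finset ℕ) else ∅) ∪ zigzagSet s (y :: rest)
  | _ => ∅

noncomputable def wsum (w : ℕ → ℝ) (X : Finset ℕ) : ℝ := ∑ b ∈ X, w b

/-- Partial sum-of-logs potential of the set `X` in tree `T` (binary logarithm). -/
noncomputable def phiOn (w : ℕ → ℝ) (T : BTree) (X : Finset ℕ) : ℝ :=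
  ∑ a ∈ X, Real.logb 2 (wsum w (subtreeKeys T a))

noncomputable def phiAll (w : ℕ → ℝ) (T : BTree) : ℝ := phiOn w T (keys T)

/-- A single access of a minimally self-adjusting BST algorithm: the accessed element `s`
becomes the root, the keys are unchanged, and every node off the search path keeps its
subtree; hence the search path is replaced by an after-tree rooted at `s` and the pendent
subtrees are reattached in the unique order-preserving way. -/
structure IsAccess (T : BTree) (s : ℕ) (T' : BTree) : Prop where
  hT : isBST T
  hT' : isBST T'
  hs : s ∈ keys T
  hkeys : keys T' = keys T
  hroot : root? T' = some s
  hpendent : ∀ a ∈ keys T, a ∉ pathSet T s → subtree? a T' = subtree? a T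

/-- The algorithm (viewed as the set of accesses it may perform) satisfies the access lemma
via the sum-of-logs potential. -/
def SatisfiesAL (Alg : BTree → ℕ → BTree → Prop) : Prop :=
  ∃ C : ℝ, 0 ≤ C ∧ ∀ T s T', Alg T s T' → ∀ w : ℕ → ℝ, (∀ i ∈ keys T, 0 < w i) →
    ((pathSet T s).card : ℝ) ≤
      phiAll w T - phiAll w T' + C * (1 + Real.logb 2 (wsum w (keys T) / w s))

/-- `X` is subtree-disjoint (w.r.t. the tree after the access). -/
def SubtreeDisjoint (T' : BTree) (X : Finset ℕ) : Prop :=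
  ∀ a ∈ X, ∀ b ∈ X, a ≠ b → subtreeKeys T' a ∩ subtreeKeys T' b = ∅

/-- `X` is monotone: all elements on one side of `s`, with equal right-depth
(resp. left-depth) in the after-tree.  (For nodes of the search path, depth in the
after-tree coincides with depth in `T'`.) -/
def IsMonotone (s : ℕ) (T' : BTree) (X : Finset ℕ) : Prop :=
  ((∀ x ∈ X, s < x) ∧ ∃ d, ∀ x ∈ X, rightDepth x T' = d) ∨
  ((∀ x ∈ X, x < s) ∧ ∃ d, ∀ x ∈ X, leftDepth x T' = d)

/-- The after-tree minus its root can be partitioned into (at most) `k` monotone sets. -/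
def MonotoneDecomp (T : BTree) (s : ℕ) (T' : BTree) (k : ℕ) : Prop :=
  ∃ M : Fin k → Finset ℕ,
    (∀ i, IsMonotone s T' (M i)) ∧
    (∀ i j, i ≠ j → Disjoint (M i) (M j)) ∧
    Finset.univ.biUnion M = pathSet T s \ {s}

/-- The leaves of the after-tree: path nodes having no path node as proper descendant in `T'`. -/
def afterLeaves (T : BTree) (s : ℕ) (T' : BTree) : Finset ℕ :=
  (pathSet T s).filter (fun x => subtreeKeys T' x ∩ pathSet T s = {x})

/-- Rotate-to-root: `s` becomes the root and ancestor relations are otherwise preserved,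
equivalently `T'(a) = T(a) ∩ (-∞,s)` for path nodes `a < s` and symmetrically for `a > s`. -/
def IsRotateToRoot (T : BTree) (s : ℕ) (T' : BTree) : Prop :=
  subtreeKeys T' s = keys T ∧
  ∀ a ∈ pathSet T s,
    (a < s → subtreeKeys T' a = (subtreeKeys T a).filter (fun b => b < s)) ∧
    (s < a → subtreeKeys T' a = (subtreeKeys T a).filter (fun b => s < b))

def pendTree : Option ℕ → BTree
  | none => BTree.nil
  | some u => BTree.node BTree.nil u BTree.nil

def buildLeft (l : List (ℕ × Option ℕ)) : BTree :=
  l.foldl (fun t vc => BTree.node (pendTree vc.2) vc.1 t) BTree.nil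

def buildRight (l : List (ℕ × Option ℕ)) : BTree :=
  l.foldl (fun t vc => BTree.node t vc.1 (pendTree vc.2)) BTree.nil

/-- Global view of splay: process the reversed search path `v₁, v₂, …` in pairs; if a pair
lies on the same side of `s`, the more ancestral element is removed from its path and
becomes a (pendant) child of the other.  Returns the two spines (elements `< s` and `> s`),
deepest first, each spine node with its optional pendant child. -/
def splaySpines (s : ℕ) : List ℕ → List (ℕ × Option ℕ) × List (ℕ × Option ℕ)
  | [] => ([], [])
  | [v] => if v < s then ([(v, none)], []) else ([], [(v, none)])
  | v :: u :: rest =>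
    let p := splaySpines s rest
    if v < s then
      if u < s then ((v, some u) :: p.1, p.2)
      else ((v, none) :: p.1, (u, none) :: p.2)
    else
      if u < s then ((u, none) :: p.1, (v, none) :: p.2)
      else (p.1, (v, some u) :: p.2)

/-- The after-tree of a splay access, built from the reversed search path without `s`. -/
def splayAfterTree (s : ℕ) (l : List ℕ) : BTree :=
  BTree.node (buildLeft (splaySpines s l).1) s (buildRight (splaySpines s l).2)

/-- A splay access: a valid access whose after-tree (the restriction of `T'` to the search
path) is the splay after-tree. -/
def IsSplayAccess (T : BTree) (s : ℕ) (T' : BTree) : Prop :=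
  IsAccess T s T' ∧
  ∀ x ∈ pathSet T s,
    subtreeKeys T' x ∩ pathSet T s = subtreeKeys (splayAfterTree s (pathList s T).reverse.tail) x

/-- A path-balance access: a valid access whose after-tree is a balanced BST of depth
`⌈log₂ (1 + |P|)⌉` rooted at `s`. -/
def IsPathBalanceAccess (T : BTree) (s : ℕ) (T' : BTree) : Prop :=
  IsAccess T s T' ∧
  ∀ x ∈ pathSet T s, nodeDepth x T' ≤ Nat.clog 2 (1 + (pathSet T s).card)

def isParent (Q : BTree) (x y : ℕ) : Prop := pathList y Q = pathList x Q ++ [y]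

/-- One step of a decomposition: a (descending) path `Pi` of `Q` is rearranged into a tree,
all other nodes keeping their subtrees. -/
def StepRel (Q Q' : BTree) (Pi : Finset ℕ) : Prop :=
  isBST Q' ∧ keys Q' = keys Q ∧
  (∃ l : List ℕ, l ≠ [] ∧ List.Chain' (isParent Q) l ∧ l.toFinset = Pi) ∧
  (∀ a ∈ keys Q, a ∉ Pi → subtree? a Q' = subtree? a Q)

/-- The transformation of the before-path `P0` (as a tree) into the after-tree `A` admits a
local decomposition with window size `wdw`. -/
def HasLocalDecomp (s : ℕ) (P0 A : BTree) (wdw : ℕ) : Prop :=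
  ∃ (k : ℕ) (Q : ℕ → BTree) (Ps : ℕ → Finset ℕ),
    1 ≤ k ∧ Q 0 = P0 ∧ Q k = A ∧
    (∀ i < k, StepRel (Q i) (Q (i + 1)) (Ps i)) ∧
    s ∈ Ps 0 ∧
    (∀ i, i + 1 < k → (Ps (i + 1) \ Ps i).Nonempty) ∧
    (∀ i, i + 1 < k → (Ps (i + 1) ∩ Ps i).Nonempty) ∧
    (∀ i j, i + 1 < j → j < k → Disjoint (Ps i \ Ps (i + 1)) (Ps j)) ∧
    (∀ i < k, (Ps i).card ≤ wdw)

/-- The search path to `s` in `T`, as a tree (the before-path of the transformation). -/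
def pathTree (s : ℕ) : BTree → BTree
  | BTree.nil => BTree.nil
  | BTree.node l x r =>
    if s = x then BTree.node BTree.nil x BTree.nil
    else if s < x then BTree.node (pathTree s l) x BTree.nil
    else BTree.node BTree.nil x (pathTree s r)

/-- `A` is the after-tree of the access `(T, s, T')`: the restriction of `T'` to the search path. -/
def IsAfterTree (T : BTree) (s : ℕ) (T' A : BTree) : Prop :=
  isBST A ∧ keys A = pathSet T s ∧
  ∀ x ∈ pathSet T s, subtreeKeys A x = subtreeKeys T' x ∩ pathSet T s

/-- The algorithm is local with window size `wdw`. -/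
def IsLocal (Alg : BTree → ℕ → BTree → Prop) (wdw : ℕ) : Prop :=
  ∀ T s T', Alg T s T' → ∀ A, IsAfterTree T s T' A → HasLocalDecomp s (pathTree s T) A wdw

open scoped Classical in
noncomputable def stair (n : ℕ) (h : ℕ → ℕ) (s : ℕ) : Finset ℕ :=
  (Finset.Icc 1 n).filter
    (fun b => ∀ b' ∈ Finset.Icc 1 n, ((s < b' ∧ b' < b) ∨ (b < b' ∧ b' < s)) → h b' < h b)

open scoped Classical in
noncomputable def nbhd (n : ℕ) (h : ℕ → ℕ) (a : ℕ) : Finset ℕ :=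
  (Finset.Icc 1 n).filter
    (fun b => ∀ b' ∈ Finset.Icc 1 n, b' ≠ a → min a b ≤ b' → b' ≤ max a b → h b' < h a)

/-- Geometric sum-of-logs partial potential. -/
noncomputable def phiGeo (n : ℕ) (h : ℕ → ℕ) (w : ℕ → ℝ) (X : Finset ℕ) : ℝ :=
  ∑ a ∈ X, Real.logb 2 (wsum w (nbhd n h a))

/-- `l` is (the reversal of) a valid search path to `s`, without `s`, deepest element first. -/
def ValidRevPath (s : ℕ) (l : List ℕ) : Prop :=
  l.Nodup ∧ s ∉ l ∧
  l.Pairwise (fun a b => (a < s → b < s → b < a) ∧ (s < a → s < b → a < b))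

end Paper

namespace Paper

namespace BTree

theorem subtreeKeys_node (l r : BTree) (v x : ℕ) :
    subtreeKeys (node l v r) x =
      if x = v then keys (node l v r)
      else if x < v then subtreeKeys l x else subtreeKeys r x := by
  unfold subtreeKeys
  rw [subtree?]
  split_ifs <;> rfl

theorem subtreeKeys_subset_keys (T : BTree) (x : ℕ) : subtreeKeys T x ⊆ keys T := by
  induction T with
  | nil => simp [subtreeKeys, subtree?]
  | node l v r ihl ihr =>
    intro y hy
    rw [subtreeKeys_node] at hy
    split_ifs at hy
    · exact hy
    · simp [keys, ihl hy]
    · simp [keys, ihr hy]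

theorem self_mem_subtreeKeys {T : BTree} (hT : isBST T) {x : ℕ} (hx : x ∈ keys T) :
    x ∈ subtreeKeys T x := by
  induction T with
  | nil => simp [keys] at hx
  | node l v r ihl ihr =>
    obtain ⟨hl, hr, hTl, hTr⟩ := hT
    have hx' := hx
    simp only [keys, Finset.mem_insert, Finset.mem_union] at hx'
    rw [subtreeKeys_node]
    grind

theorem pathSet_subset_keys (T : BTree) (s : ℕ) : pathSet T s ⊆ keys T := by
  induction T with
  | nil => simp [pathSet, pathList]
  | node l v r ihl ihr =>
    intro x hx
    simp only [pathSet, List.mem_toFinset, Finset.subset_iff] at hx ihl ihr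
    rw [pathList] at hx
    simp only [keys, Finset.mem_insert, Finset.mem_union]
    grind

/-- The subtree of a node `x` of the search path to `s` contains every key between `s` and `x`. -/
theorem mem_subtreeKeys_of_mem_pathSet {T : BTree} (hT : isBST T) {s x y : ℕ}
    (hs : s ∈ keys T) (hx : x ∈ pathSet T s) (hy : y ∈ keys T)
    (hsy : min s x ≤ y) (hyx : y ≤ max s x) : y ∈ subtreeKeys T x := by
  induction T with
  | nil => simp [keys] at hs
  | node l v r ihl ihr =>
    obtain ⟨hl, hr, hTl, hTr⟩ := hT
    rw [subtreeKeys_node]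
    by_cases hxv : x = v
    · rwa [if_pos hxv]
    have hlx := pathSet_subset_keys l s
    have hrx := pathSet_subset_keys r s
    simp only [pathSet, List.mem_toFinset, Finset.subset_iff] at hx ihl ihr hlx hrx
    rw [pathList] at hx
    simp only [keys, Finset.mem_insert, Finset.mem_union] at hs hy
    grind

theorem rightDepth_lt_of_mem_subtreeKeys {T : BTree} (hT : isBST T) {x y z : ℕ}
    (hy : y ∈ subtreeKeys T x) (hxz : x < z) (hzy : z ≤ y) :
    rightDepth x T < rightDepth z T := by
  induction T with
  | nil => simp [subtreeKeys, subtree?] at hy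
  | node l v r ihl ihr =>
    obtain ⟨hl, hr, hTl, hTr⟩ := hT
    have hly := subtreeKeys_subset_keys l x
    rw [subtreeKeys_node] at hy
    simp only [rightDepth]
    grind

theorem leftDepth_lt_of_mem_subtreeKeys {T : BTree} (hT : isBST T) {x y z : ℕ}
    (hy : y ∈ subtreeKeys T x) (hzx : z < x) (hyz : y ≤ z) :
    leftDepth x T < leftDepth z T := by
  induction T with
  | nil => simp [subtreeKeys, subtree?] at hy
  | node l v r ihl ihr =>
    obtain ⟨hl, hr, hTl, hTr⟩ := hT
    have hry := subtreeKeys_subset_keys r x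
    rw [subtreeKeys_node] at hy
    simp only [leftDepth]
    grind

theorem lt_of_mem_subtreeKeys_of_root_lt {T : BTree} (hT : isBST T) {s x y : ℕ}
    (hroot : root? T = some s) (hy : y ∈ subtreeKeys T x) (hsx : s < x) : s < y := by
  cases T with
  | nil => simp [root?] at hroot
  | node l v r =>
    obtain rfl : v = s := by simpa [root?] using hroot
    rw [subtreeKeys_node, if_neg hsx.ne', if_neg hsx.not_gt] at hy
    exact hT.2.1 y (subtreeKeys_subset_keys r x hy)

theorem lt_of_mem_subtreeKeys_of_lt_root {T : BTree} (hT : isBST T) {s x y : ℕ}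
    (hroot : root? T = some s) (hy : y ∈ subtreeKeys T x) (hxs : x < s) : y < s := by
  cases T with
  | nil => simp [root?] at hroot
  | node l v r =>
    obtain rfl : v = s := by simpa [root?] using hroot
    rw [subtreeKeys_node, if_neg hxs.ne, if_pos hxs] at hy
    exact hT.1 y (subtreeKeys_subset_keys l x hy)

end BTree

/-- If `f` at each element is bounded by `g` at every later element, the sums of `f` and `g`
differ by at most the gap between an upper bound of `f` and a lower bound of `g`. -/
theorem sum_le_sum_add_sub_of_shift {ι : Type*} [LinearOrder ι] (f g : ι → ℝ) {c : ℝ}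
    (X : Finset ι) (hg : ∀ a ∈ X, c ≤ g a) (hfg : ∀ a ∈ X, ∀ b ∈ X, a < b → f a ≤ g b)
    {C : ℝ} (hcC : c ≤ C) (hf : ∀ a ∈ X, f a ≤ C) :
    ∑ a ∈ X, f a ≤ ∑ a ∈ X, g a + (C - c) := by
  induction X using Finset.induction_on_max generalizing C with
  | empty => simpa using hcC
  | insert m X hm ih =>
    have hmX : m ∉ X := fun h => (hm m h).false
    have hX := ih (C := g m) (fun a ha => hg a (Finset.mem_insert_of_mem ha))
      (fun a ha b hb => hfg a (Finset.mem_insert_of_mem ha) b (Finset.mem_insert_of_mem hb))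
      (hg m (Finset.mem_insert_self m X))
      (fun a ha => hfg a (Finset.mem_insert_of_mem ha) m (Finset.mem_insert_self m X) (hm a ha))
    have hfm := hf m (Finset.mem_insert_self m X)
    rw [Finset.sum_insert hmX, Finset.sum_insert hmX]
    linarith

theorem logb_wsum_le_logb_wsum {w : ℕ → ℝ} {A B K : Finset ℕ} (hw : ∀ i ∈ K, 0 < w i)
    (hA : A.Nonempty) (hAB : A ⊆ B) (hBK : B ⊆ K) :
    Real.logb 2 (wsum w A) ≤ Real.logb 2 (wsum w B) :=
  Real.logb_le_logb_of_le one_lt_two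
    (Finset.sum_pos (fun i hi => hw i (hBK (hAB hi))) hA)
    (Finset.sum_le_sum_of_subset_of_nonneg hAB fun i hi _ => (hw i (hBK hi)).le)

end Paper

open Paper Paper.BTree
/-- **Lemma (monotone sets).** For any access and any monotone set `X` of nodes of the
search path: `Φ_T(X) − Φ_{T'}(X) + log(W / w(s)) ≥ 0`. -/
theorem monotone_set_lemma (T : BTree) (s : ℕ) (T' : BTree) (hacc : IsAccess T s T')
    (X : Finset ℕ) (hX : X ⊆ pathSet T s) (hmono : IsMonotone s T' X)
    (w : ℕ → ℝ) (hw : ∀ i ∈ keys T, 0 < w i) :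
    0 ≤ phiOn w T X - phiOn w T' X + Real.logb 2 (wsum w (keys T) / w s) := by
  obtain ⟨hT, hT', hs, hkeys, hroot, -⟩ := hacc
  have hws : wsum w {s} = w s := Finset.sum_singleton w s
  have hW : 0 < wsum w (keys T) := Finset.sum_pos hw ⟨s, hs⟩
  have hXT : X ⊆ keys T := hX.trans (pathSet_subset_keys T s)
  have hne : ∀ a ∈ X, (subtreeKeys T' a).Nonempty := fun a ha =>
    ⟨a, self_mem_subtreeKeys hT' (hkeys ▸ hXT ha)⟩
  have hsub : ∀ a, subtreeKeys T' a ⊆ keys T := fun a => hkeys ▸ subtreeKeys_subset_keys T' a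
  have hlow : ∀ a ∈ X, Real.logb 2 (w s) ≤ Real.logb 2 (wsum w (subtreeKeys T a)) := by
    intro a ha
    rw [← hws]
    refine logb_wsum_le_logb_wsum hw (Finset.singleton_nonempty s) ?_ (subtreeKeys_subset_keys T a)
    rw [Finset.singleton_subset_iff]
    exact mem_subtreeKeys_of_mem_pathSet hT hs (hX ha) hs (min_le_left _ _) (le_max_left _ _)
  have hup : ∀ a ∈ X, Real.logb 2 (wsum w (subtreeKeys T' a)) ≤ Real.logb 2 (wsum w (keys T)) :=
    fun a ha => logb_wsum_le_logb_wsum hw (hne a ha) (hsub a) subset_rfl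
  have hsW : Real.logb 2 (w s) ≤ Real.logb 2 (wsum w (keys T)) := by
    rw [← hws]
    exact logb_wsum_le_logb_wsum hw (Finset.singleton_nonempty s)
      (Finset.singleton_subset_iff.2 hs) subset_rfl
  rw [Real.logb_div hW.ne' (hw s hs).ne']
  suffices h : phiOn w T' X ≤ phiOn w T X +
      (Real.logb 2 (wsum w (keys T)) - Real.logb 2 (w s)) by linarith
  rcases hmono with ⟨hsX, d, hd⟩ | ⟨hsX, d, hd⟩
  · refine sum_le_sum_add_sub_of_shift _ _ X hlow (fun a ha b hb hab => ?_) hsW hup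
    refine logb_wsum_le_logb_wsum hw (hne a ha) (fun y hy => ?_) (subtreeKeys_subset_keys T b)
    have hsy := lt_of_mem_subtreeKeys_of_root_lt hT' hroot hy (hsX a ha)
    have hyb : y < b := by
      by_contra! hby
      have := rightDepth_lt_of_mem_subtreeKeys hT' hy hab hby
      rw [hd a ha, hd b hb] at this
      exact this.false
    exact mem_subtreeKeys_of_mem_pathSet hT hs (hX hb) (hsub a hy)
      (min_le_of_left_le hsy.le) (le_max_of_le_right hyb.le)
  · refine sum_le_sum_add_sub_of_shift (ι := ℕᵒᵈ) (fun a => Real.logb 2 (wsum w (subtreeKeys T' a)))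
      (fun a => Real.logb 2 (wsum w (subtreeKeys T a))) X hlow
      (fun (a : ℕ) ha (b : ℕ) hb (hab : b < a) => ?_) hsW hup
    refine logb_wsum_le_logb_wsum hw (hne a ha) (fun y hy => ?_) (subtreeKeys_subset_keys T b)
    have hys := lt_of_mem_subtreeKeys_of_lt_root hT' hroot hy (hsX a ha)
    have hby : b < y := by
      by_contra! hyb
      have := leftDepth_lt_of_mem_subtreeKeys hT' hy hab hyb
      rw [hd a ha, hd b hb] at this
      exact this.false
    exact mem_subtreeKeys_of_mem_pathSet hT hs (hX hb) (hsub a hy)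
      (min_le_of_right_le hby.le) (le_max_of_le_left hys.le)
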